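/- arXiv:2406.07326 — 2 statements merged into one kernel-verified Lean document; each statement's English description precedes it below -/
import Mathlib

section
/- Let q be a prime power, F a finite field with q^2 elements, 1 < d ≤ q, and G ∈ F[x_0,...,x_4] a nonzero homogeneous polynomial of degree d. Suppose that some line ℓ of ℙ^4(F) with |ℓ ∩ V_3| = 1 (a tangent line to V_3) is contained in V(G)(F), and that no plane of ℙ^4(F) is contained in V(G)(F). Then |V(G)(F) ∩ V_3| ≤ (d−1)q^5 + (d−1)q^4 + dq^3 + dq^2 + 1 < d(q^5 + q^2) + q^3 + 1. -/
open MvPolynomial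

noncomputable section

/-- The projective space ℙ⁴(F): 1-dimensional F-linear subspaces of F⁵. -/
abbrev P4 (F : Type) [Field F] := Projectivization F (Fin 5 → F)

/-- The non-degenerate Hermitian threefold
    V₃ = {[x] ∈ ℙ⁴(F) : x₀^{q+1} + ⋯ + x₄^{q+1} = 0}. -/
def hermV3 (q : ℕ) (F : Type) [Field F] : Set (P4 F) :=
  {x | ∑ i, x.rep i ^ (q + 1) = 0}

/-- V(G)(F) = {[x] ∈ ℙ⁴(F) : G(x) = 0}, for G homogeneous this is well defined. -/
def VG {F : Type} [Field F] (G : MvPolynomial (Fin 5) F) : Set (P4 F) :=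
  {x | eval x.rep G = 0}

/-- The set of points of ℙ⁴(F) contained in an F-linear subspace of F⁵ of dimension k. -/
def IsLinSub (F : Type) [Field F] (k : ℕ) (S : Set (P4 F)) : Prop :=
  ∃ W : Submodule F (Fin 5 → F), Module.finrank F W = k ∧
    S = {x : P4 F | x.submodule ≤ W}

/-- A line of ℙ⁴(F). -/
def IsLine (F : Type) [Field F] (S : Set (P4 F)) : Prop := IsLinSub F 2 S

/-- A plane of ℙ⁴(F). -/
def IsPlane (F : Type) [Field F] (S : Set (P4 F)) : Prop := IsLinSub F 3 S

/-- A hyperplane of ℙ⁴(F). -/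
def IsHyperplane (F : Type) [Field F] (S : Set (P4 F)) : Prop := IsLinSub F 4 S

/-- The tangent hyperplane T_P(V₃) = {[x] : a₀^q x₀ + ⋯ + a₄^q x₄ = 0} where P = [a]. -/
def tangentHyp (q : ℕ) {F : Type} [Field F] (P : P4 F) : Set (P4 F) :=
  {x | ∑ i, P.rep i ^ q * x.rep i = 0}

/-- A subset of ℙ⁴(F) is a tangent hyperplane to V₃ if it equals T_P(V₃) for some P ∈ V₃. -/
def IsTangentHyp (q : ℕ) {F : Type} [Field F] (S : Set (P4 F)) : Prop :=
  ∃ P ∈ hermV3 q F, S = tangentHyp q P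

/-- The monomial `x ^ a * y ^ b` as a function on a finite set of points of the affine plane. -/
def planeMonomial {F : Type} [Field F] (Z : Finset (Fin 2 → F)) (a b : ℕ) : Z → F :=
  fun z => z.1 0 ^ a * z.1 1 ^ b

/-- The span of the monomials `x ^ a * y ^ b` of weight `a * q + b * (q + 1)` less than `N`. -/
def weightSpan {F : Type} [Field F] (Z : Finset (Fin 2 → F)) (q N : ℕ) : Submodule F (Z → F) :=
  Submodule.span F {f | ∃ a b, a * q + b * (q + 1) < N ∧ f = planeMonomial Z a b}

section Curve

variable {F : Type} [Field F] {Z : Finset (Fin 2 → F)} {q : ℕ}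

lemma planeMonomial_mem_weightSpan {a b N : ℕ} (h : a * q + b * (q + 1) < N) :
    planeMonomial Z a b ∈ weightSpan Z q N :=
  Submodule.subset_span ⟨a, b, h, rfl⟩

lemma weightSpan_mono {M N : ℕ} (h : M ≤ N) : weightSpan Z q M ≤ weightSpan Z q N :=
  Submodule.span_mono fun _ ⟨a, b, hab, hf⟩ => ⟨a, b, hab.trans_le h, hf⟩

lemma planeMonomial_mul (a b a' b' : ℕ) :
    planeMonomial Z a b * planeMonomial Z a' b' = planeMonomial Z (a + a') (b + b') := by
  funext z
  simp only [planeMonomial, Pi.mul_apply]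
  ring

lemma planeMonomial_mul_mem {a b N : ℕ} {f : Z → F} (hf : f ∈ weightSpan Z q N) :
    planeMonomial Z a b * f ∈ weightSpan Z q (a * q + b * (q + 1) + N) := by
  induction hf using Submodule.span_induction with
  | mem f hf =>
    obtain ⟨a', b', h, rfl⟩ := hf
    rw [planeMonomial_mul]
    apply planeMonomial_mem_weightSpan
    nlinarith
  | zero => simp
  | add f g _ _ hf hg => rw [mul_add (planeMonomial Z a b)]; exact add_mem hf hg
  | smul c f _ hf => rw [mul_smul_comm]; exact Submodule.smul_mem _ _ hf

lemma planeMonomial_reduce (hq : 1 < q) {e : F}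
    (hZ : ∀ z ∈ Z, z 1 ^ q + z 1 = z 0 ^ (q + 1) + e) (a b k : ℕ) :
    planeMonomial Z (a + k * (q + 1)) b - planeMonomial Z a (b + k * q) ∈
      weightSpan Z q (a * q + (b + k * q) * (q + 1)) := by
  induction k generalizing a with
  | zero => simp
  | succ k ih =>
    have h1 := ih (a + (q + 1))
    have e1 : planeMonomial Z (a + (k + 1) * (q + 1)) b
        - planeMonomial Z a (b + (k + 1) * q) =
        (planeMonomial Z (a + (q + 1) + k * (q + 1)) b
          - planeMonomial Z (a + (q + 1)) (b + k * q)) +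
        (planeMonomial Z a (b + k * q + 1) - e • planeMonomial Z a (b + k * q)) := by
      funext z
      have hz := hZ z.1 z.2
      have h2 : z.1 0 ^ (q + 1) = z.1 1 ^ q + z.1 1 - e := by rw [hz]; ring
      have h3 : z.1 0 ^ ((k + 1) * (q + 1)) = z.1 0 ^ (k * (q + 1)) * z.1 0 ^ (q + 1) := by ring
      simp only [planeMonomial, Pi.sub_apply, Pi.add_apply, Pi.smul_apply, smul_eq_mul, pow_add _ a,
        pow_add _ (a + (q + 1)), h3, h2, add_mul k 1 q, one_mul, pow_add _ b, pow_add _ (k * q),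
        pow_add _ (b + k * q)]
      ring
    rw [e1]
    refine add_mem (weightSpan_mono (le_of_eq (by ring)) h1) (sub_mem ?_ (Submodule.smul_mem _ _ ?_))
    · apply planeMonomial_mem_weightSpan
      nlinarith
    · apply planeMonomial_mem_weightSpan
      nlinarith

lemma planeMonomial_sub_mem (hq : 1 < q) {e : F}
    (hZ : ∀ z ∈ Z, z 1 ^ q + z 1 = z 0 ^ (q + 1) + e) {a b a' b' : ℕ}
    (h : a * q + b * (q + 1) = a' * q + b' * (q + 1)) :
    planeMonomial Z a b - planeMonomial Z a' b' ∈ weightSpan Z q (a * q + b * (q + 1)) := by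
  wlog hb : b ≤ b' generalizing a b a' b'
  · rw [← neg_sub, h]
    exact neg_mem (this h.symm (by omega))
  have h1 : a' + b' ≤ a + b := by
    by_contra! hlt
    nlinarith
  obtain ⟨k, hk⟩ := Nat.exists_eq_add_of_le h1
  obtain ⟨c, rfl⟩ := Nat.exists_eq_add_of_le hb
  have hc : c = k * q := by nlinarith
  have ha : a = a' + k * (q + 1) := by rw [mul_add, ← hc]; omega
  subst hc ha
  rw [h]
  exact planeMonomial_reduce hq hZ a' b k

lemma finrank_weightSpan_le (hq : 1 < q) {e : F}
    (hZ : ∀ z ∈ Z, z 1 ^ q + z 1 = z 0 ^ (q + 1) + e) {a b : ℕ}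
    (hab : planeMonomial Z a b ∈ weightSpan Z q (a * q + b * (q + 1))) (N : ℕ) :
    Module.finrank F (weightSpan Z q N) ≤ a * q + b * (q + 1) := by
  classical
  set w := a * q + b * (q + 1) with hw
  set L : ℕ → Prop := fun n => ∃ i j, n = i * q + j * (q + 1) with hL
  have hLw : ∀ n, L n → L (n + w) := by
    rintro n ⟨i, j, rfl⟩
    exact ⟨i + a, j + b, by rw [hw]; ring⟩
  have hLk : ∀ n, L n → ∀ k, L (n + k * w) := by
    intro n hn k
    induction k with
    | zero => simpa using hn
    | succ k ih => rw [add_mul, one_mul, ← add_assoc]; exact hLw _ ih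
  have key : Module.finrank F (weightSpan Z q N) ≤
      ((Finset.range N).filter fun n => L n ∧ ∀ m, L m → n ≠ m + w).card := by
    induction N with
    | zero =>
      have : weightSpan Z q 0 = (⊥ : Submodule F (Z → F)) := by simp [weightSpan]
      simp [this]
    | succ N ih =>
      by_cases hN : L N ∧ ∀ m, L m → N ≠ m + w
      · obtain ⟨⟨i, j, hij⟩, -⟩ := id hN
        have hsub : weightSpan Z q (N + 1) ≤
            weightSpan Z q N ⊔ Submodule.span F {planeMonomial Z i j} := by
          refine Submodule.span_le.mpr ?_
          rintro _ ⟨i', j', h', rfl⟩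
          rcases Nat.lt_succ_iff_lt_or_eq.mp h' with h' | h'
          · exact Submodule.mem_sup_left (planeMonomial_mem_weightSpan h')
          · have := planeMonomial_sub_mem hq hZ (h'.trans hij)
            rw [h'] at this
            have h2 := Submodule.add_mem_sup this
              (Submodule.mem_span_singleton_self (R := F) (planeMonomial Z i j))
            simpa using h2
        rw [Finset.range_add_one, Finset.filter_insert, if_pos hN, Finset.card_insert_of_notMem
          (by simp)]
        calc _ ≤ _ := Submodule.finrank_mono hsub
          _ ≤ _ := Submodule.finrank_add_le_finrank_add_finrank _ _
          _ ≤ _ := add_le_add ih ((finrank_span_le_card _).trans (by simp))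
      · have hsub : weightSpan Z q (N + 1) ≤ weightSpan Z q N := by
          refine Submodule.span_le.mpr ?_
          rintro _ ⟨i', j', h', rfl⟩
          rcases Nat.lt_succ_iff_lt_or_eq.mp h' with h' | h'
          · exact planeMonomial_mem_weightSpan h'
          · push Not at hN
            obtain ⟨m, ⟨i, j, hm⟩, hmN⟩ := hN ⟨i', j', h'.symm⟩
            have h3 : i' * q + j' * (q + 1) = (i + a) * q + (j + b) * (q + 1) := by
              rw [h', hmN, hm, hw]; ring
            have h4 := planeMonomial_sub_mem hq hZ h3
            have h5 := planeMonomial_mul_mem (a := i) (b := j) hab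
            rw [planeMonomial_mul] at h5
            rw [h'] at h4
            rw [← hm, ← hmN] at h5
            simpa using add_mem h4 h5
        rw [Finset.range_add_one, Finset.filter_insert, if_neg hN]
        exact (Submodule.finrank_mono hsub).trans ih
  refine key.trans ?_
  have hpos : ∀ n ∈ (Finset.range N).filter fun n => L n ∧ ∀ m, L m → n ≠ m + w, 0 < w := by
    intro n hn
    rw [Finset.mem_filter] at hn
    by_contra h0
    exact hn.2.2 n hn.2.1 (by omega)
  have hcard := Finset.card_le_card_of_injOn
    (s := (Finset.range N).filter fun n => L n ∧ ∀ m, L m → n ≠ m + w) (t := Finset.range w)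
    (fun n => n % w) (fun n hn => by simpa using Nat.mod_lt n (hpos n hn)) ?_
  · simpa using hcard
  intro m hm n hn hmn
  wlog hlt : m < n generalizing m n
  · rcases (not_lt.mp hlt).lt_or_eq with h | h
    · exact (this hn hm hmn.symm h).symm
    · exact h.symm
  exfalso
  simp only [Finset.coe_filter, Set.mem_ofPred_eq] at hm hn hmn
  obtain ⟨k, hk⟩ := (Nat.modEq_iff_dvd' hlt.le).mp hmn
  have hk0 : k ≠ 0 := by rintro rfl; omega
  obtain ⟨k, rfl⟩ := Nat.exists_eq_succ_of_ne_zero hk0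
  refine hn.2.2 (m + k * w) (hLk m hm.2.1 k) ?_
  have : w * (k + 1) = k * w + w := by ring
  simp only [Nat.succ_eq_add_one] at hk
  omega

lemma weightSpan_eq_top [Fintype F] (Z : Finset (Fin 2 → F)) (q : ℕ) :
    ∃ N, weightSpan Z q N = ⊤ := by
  refine ⟨2 * Fintype.card F * (q + 1) + 1, ?_⟩
  classical
  rw [eq_top_iff]
  intro f _
  have h := MvPolynomial.map_restrict_dom_evalₗ F (Fin 2)
  have hf : (fun x => if hx : x ∈ Z then f ⟨x, hx⟩ else 0) ∈
      (restrictDegree (Fin 2) F (Fintype.card F - 1)).map (evalₗ F (Fin 2)) := by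
    rw [h]; trivial
  obtain ⟨g, hg, hgf⟩ := hf
  have : f = ∑ m ∈ g.support, coeff m g • planeMonomial Z (m 0) (m 1) := by
    funext z
    have := congrFun hgf z.1
    simp only [evalₗ_apply, z.2, dif_pos] at this
    rw [← this, eval_eq']
    simp [planeMonomial, Fin.prod_univ_two]
  rw [this]
  refine Submodule.sum_mem _ fun m hm => Submodule.smul_mem _ _ (planeMonomial_mem_weightSpan ?_)
  have h0 := (mem_restrictDegree _ _ _).mp hg m hm 0
  have h1 := (mem_restrictDegree _ _ _).mp hg m hm 1
  have h0' : m 0 ≤ Fintype.card F := by omega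
  have h1' : m 1 ≤ Fintype.card F := by omega
  nlinarith [Nat.mul_le_mul_right q h0', Nat.mul_le_mul_right (q + 1) h1']

/-- A nonzero polynomial of degree at most `q` has at most as many zeros on the Hermitian curve
`y ^ q + y = x ^ (q + 1) + e` as the weight of one of its monomials. -/
theorem exists_card_le_weight [Fintype F] (hq : 1 < q) {e : F}
    (hZ : ∀ z ∈ Z, z 1 ^ q + z 1 = z 0 ^ (q + 1) + e) {g : MvPolynomial (Fin 2) F} (hg : g ≠ 0)
    (hdeg : g.totalDegree ≤ q) (hgZ : ∀ z ∈ Z, eval z g = 0) :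
    ∃ m ∈ g.support, Z.card ≤ m 0 * q + m 1 * (q + 1) := by
  obtain ⟨m, hm, hmax⟩ := Finset.exists_max_image g.support
    (fun m => m 0 * q + m 1 * (q + 1)) (by simpa [Finset.nonempty_iff_ne_empty] using hg)
  refine ⟨m, hm, ?_⟩
  have hle : ∀ n ∈ g.support, n 0 + n 1 ≤ q := by
    intro n hn
    have := (le_totalDegree hn).trans hdeg
    rwa [Finsupp.sum_fintype _ _ (by simp), Fin.sum_univ_two] at this
  have hmem : planeMonomial Z (m 0) (m 1) ∈ weightSpan Z q (m 0 * q + m 1 * (q + 1)) := by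
    have hsum : coeff m g • planeMonomial Z (m 0) (m 1) =
        - ∑ n ∈ g.support.erase m, coeff n g • planeMonomial Z (n 0) (n 1) := by
      rw [eq_neg_iff_add_eq_zero, Finset.add_sum_erase _
        (fun n => coeff n g • planeMonomial Z (n 0) (n 1)) hm]
      funext z
      have := hgZ z.1 z.2
      rw [eval_eq'] at this
      simpa [planeMonomial, Fin.prod_univ_two] using this
    have h1 : coeff m g • planeMonomial Z (m 0) (m 1) ∈
        weightSpan Z q (m 0 * q + m 1 * (q + 1)) := by
      rw [hsum]
      refine neg_mem (Submodule.sum_mem _ fun n hn => Submodule.smul_mem _ _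
        (planeMonomial_mem_weightSpan ?_))
      obtain ⟨hnm, hn⟩ := Finset.mem_erase.mp hn
      refine lt_of_le_of_ne (hmax n hn) fun heq => hnm ?_
      have hn' := hle n hn
      have hm' := hle m hm
      have hs : n 0 + n 1 = m 0 + m 1 := by
        rcases lt_trichotomy (n 0 + n 1) (m 0 + m 1) with h | h | h
        · nlinarith
        · exact h
        · nlinarith
      have h1 : n 1 = m 1 := by nlinarith
      ext i
      fin_cases i
      · simp only [Fin.zero_eta]; omega
      · exact h1
    have := Submodule.smul_mem _ (coeff m g)⁻¹ h1
    rwa [smul_smul, inv_mul_cancel₀ (mem_support_iff.mp hm), one_smul] at this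
  obtain ⟨N, hN⟩ := weightSpan_eq_top Z q
  have := finrank_weightSpan_le hq hZ hmem N
  rw [hN, finrank_top] at this
  simpa using this

end Curve

section Slices

variable {F : Type} [Field F]

lemma eval_smul_of_isHomogeneous {n d : ℕ} {G : MvPolynomial (Fin n) F} (hG : G.IsHomogeneous d)
    (c : F) (x : Fin n → F) : eval (c • x) G = c ^ d * eval x G := by
  rw [eval_eq', eval_eq', Finset.mul_sum]
  refine Finset.sum_congr rfl fun m hm => ?_
  have hd : ∑ i, m i = d := by
    by_contra h
    exact mem_support_iff.mp hm (hG.coeff_eq_zero (by rwa [Finsupp.degree_eq_sum]))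
  simp only [Pi.smul_apply, smul_eq_mul, mul_pow, Finset.prod_mul_distrib, Finset.prod_pow_eq_pow_sum,
    hd]
  ring

lemma sum_eq_of_mem_support {n d : ℕ} {G : MvPolynomial (Fin n) F} (hG : G.IsHomogeneous d)
    {m : Fin n →₀ ℕ} (hm : m ∈ G.support) : ∑ i, m i = d := by
  by_contra h
  exact mem_support_iff.mp hm (hG.coeff_eq_zero (by rwa [Finsupp.degree_eq_sum]))

/-- The coefficient of `x₀ ^ i` in `G`, restricted to `x₁ = 0`, `x₂ = 1`. -/
def coneCoeff (G : MvPolynomial (Fin 5) F) (i : ℕ) : MvPolynomial (Fin 2) F :=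
  aeval ![0, 1, X 1, X 0] ((finSuccEquiv F 4 G).coeff i)

lemma eval_coneCoeff (G : MvPolynomial (Fin 5) F) (i : ℕ) (z : Fin 2 → F) :
    eval z (coneCoeff G i) = eval ![0, 1, z 1, z 0] ((finSuccEquiv F 4 G).coeff i) := by
  rw [coneCoeff, aeval_def, eval₂_eq', eval_eq' _ ((finSuccEquiv F 4 G).coeff i), map_sum]
  refine Finset.sum_congr rfl fun m _ => ?_
  simp [Fin.prod_univ_four]

lemma totalDegree_coneCoeff_le {d : ℕ} {G : MvPolynomial (Fin 5) F} (hG : G.IsHomogeneous d)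
    {i j : ℕ} (hij : i + j = d) : (coneCoeff G i).totalDegree ≤ j := by
  rw [coneCoeff, aeval_def, eval₂_eq']
  refine totalDegree_finsetSum_le fun m hm => ?_
  have hs := sum_eq_of_mem_support (hG.finSuccEquiv_coeff_isHomogeneous i j hij) hm
  rw [Fin.sum_univ_four] at hs
  have : (algebraMap F (MvPolynomial (Fin 2) F)) (coeff m ((finSuccEquiv F 4 G).coeff i)) *
      ∏ i, (![0, 1, X 1, X 0] : Fin 4 → MvPolynomial (Fin 2) F) i ^ m i =
      C (coeff m ((finSuccEquiv F 4 G).coeff i) * 0 ^ m 0) * (X 1 ^ m 2 * X 0 ^ m 3) := by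
    simp [Fin.prod_univ_four, algebraMap_eq]
    ring
  rw [this]
  refine (totalDegree_mul _ _).trans ?_
  rw [totalDegree_C, zero_add]
  refine (totalDegree_mul _ _).trans ?_
  rw [totalDegree_X_pow, totalDegree_X_pow]
  omega

lemma coeff_coneCoeff {d : ℕ} {G : MvPolynomial (Fin 5) F} (hG : G.IsHomogeneous d)
    {i j : ℕ} (hij : i + j = d) :
    coeff (Finsupp.single 1 j) (coneCoeff G i) =
      eval ![0, 0, 1, 0] ((finSuccEquiv F 4 G).coeff i) := by
  rw [coneCoeff, aeval_def, eval₂_eq', eval_eq' _ ((finSuccEquiv F 4 G).coeff i), coeff_sum]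
  refine Finset.sum_congr rfl fun m hm => ?_
  have hs := sum_eq_of_mem_support (hG.finSuccEquiv_coeff_isHomogeneous i j hij) hm
  rw [Fin.sum_univ_four] at hs
  have h1 : (algebraMap F (MvPolynomial (Fin 2) F)) (coeff m ((finSuccEquiv F 4 G).coeff i)) *
      ∏ i, (![0, 1, X 1, X 0] : Fin 4 → MvPolynomial (Fin 2) F) i ^ m i =
      monomial (Finsupp.single 1 (m 2) + Finsupp.single 0 (m 3))
        (coeff m ((finSuccEquiv F 4 G).coeff i) * 0 ^ m 0) := by
    rw [← mul_one (coeff m _ * 0 ^ m 0), ← mul_one (coeff m _ * 0 ^ m 0), mul_assoc _ (1 : F) 1,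
      ← C_mul_monomial, ← monomial_mul, ← X_pow_eq_monomial, ← X_pow_eq_monomial]
    simp [Fin.prod_univ_four, algebraMap_eq]
    ring
  rw [h1, coeff_monomial]
  simp only [Fin.prod_univ_four, Matrix.cons_val_zero, Matrix.cons_val_one, Matrix.cons_val]
  by_cases h0 : m 0 = 0
  · by_cases h3 : m 3 = 0
    · by_cases h1 : m 1 = 0
      · have : m 2 = j := by omega
        simp [h0, h3, h1, this]
      · have : m 2 ≠ j := by omega
        simp [h0, h3, h1, this, (Finsupp.single_injective _).eq_iff]
    · rw [if_neg]
      · simp [h3]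
      · intro h
        have := DFunLike.congr_fun h 0
        simp [h3] at this
  · simp [h0]

variable [Fintype F]

lemma eq_zero_of_eval_eq_zero {σ : Type} [Finite σ] {G : MvPolynomial σ F}
    (hdeg : G.totalDegree < Fintype.card F) (h : ∀ x, eval x G = 0) : G = 0 :=
  eq_zero_of_eval_zero_at_prod_finset G (fun _ => Finset.univ)
    (fun i => (degreeOf_le_totalDegree G i).trans_lt hdeg) (fun x _ => h x)

lemma coeff_eq_zero_of_vanishing_on_line {d : ℕ} {G : MvPolynomial (Fin 5) F}
    (hG : G.IsHomogeneous d) (hd : d < Fintype.card F)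
    (hline : ∀ p u, eval ![p, 0, 0, 0, u] G = 0) {m : Fin 5 →₀ ℕ} (hm : m 0 + m 4 = d) :
    coeff m G = 0 := by
  classical
  set k : MvPolynomial (Fin 5) F :=
    ∑ n ∈ G.support.filter (fun n => n 0 + n 4 = d), monomial n (coeff n G) with hk
  have hk0 : k = 0 := by
    refine eq_zero_of_eval_eq_zero (lt_of_le_of_lt (totalDegree_finsetSum_le fun n hn => ?_) hd) ?_
    · refine (totalDegree_monomial_le _ _).trans ?_
      rw [Finsupp.sum_fintype _ _ (by simp)]
      exact (sum_eq_of_mem_support hG (Finset.mem_filter.mp hn).1).le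
    · intro x
      rw [← hline (x 0) (x 4), hk, map_sum, eval_eq', Finset.sum_filter]
      refine Finset.sum_congr rfl fun n hn => ?_
      have hs := sum_eq_of_mem_support hG hn
      rw [Fin.sum_univ_five] at hs
      split_ifs with h
      · have h1 : n 1 = 0 := by omega
        have h2 : n 2 = 0 := by omega
        have h3 : n 3 = 0 := by omega
        simp [eval_monomial, Finsupp.prod_fintype, Fin.prod_univ_five, h1, h2, h3]
      · have h1 : n 1 ≠ 0 ∨ n 2 ≠ 0 ∨ n 3 ≠ 0 := by omega
        rcases h1 with h1 | h1 | h1 <;> simp [Fin.prod_univ_five, h1]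
  by_contra hne
  apply hne
  have := congrArg (coeff m) hk0
  rw [hk, coeff_sum, coeff_zero] at this
  simp only [coeff_monomial] at this
  rw [Finset.sum_ite_eq' _ m, if_pos] at this
  · exact this
  · simp [hm, hne]

lemma card_affine_slice_le {q d : ℕ} (hd1 : 1 < d) (hdq : d ≤ q) (hF : Fintype.card F = q ^ 2)
    {G : MvPolynomial (Fin 5) F} (hG : G.IsHomogeneous d)
    (hline : ∀ p u, eval ![p, 0, 0, 0, u] G = 0) (s t : F)
    (hplane : ∃ p r u, eval ![p, r, r * s, r * t, u] G ≠ 0) {e : F} {Z : Finset (Fin 2 → F)}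
    (hZ : ∀ z ∈ Z, z 1 ^ q + z 1 = z 0 ^ (q + 1) + e)
    (hGZ : ∀ z ∈ Z, eval ![z 1, 1, s, t, z 0] G = 0) :
    Z.card ≤ (d - 1) * (q + 1) := by
  have hdF : d < Fintype.card F := by rw [hF]; nlinarith
  set g : MvPolynomial (Fin 2) F := aeval ![X 1, 1, C s, C t, X 0] G with hg
  have hev : ∀ z, eval z g = eval ![z 1, 1, s, t, z 0] G := by
    intro z
    rw [hg, aeval_def, eval₂_eq', eval_eq' _ G, map_sum]
    refine Finset.sum_congr rfl fun m _ => ?_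
    simp [Fin.prod_univ_five]
  have hdeg : g.totalDegree ≤ d - 1 := by
    rw [hg, aeval_def, eval₂_eq']
    refine totalDegree_finsetSum_le fun m hm => ?_
    have hs := sum_eq_of_mem_support hG hm
    rw [Fin.sum_univ_five] at hs
    have hne : m 0 + m 4 ≠ d := fun h =>
      mem_support_iff.mp hm (coeff_eq_zero_of_vanishing_on_line hG hdF hline h)
    have : (algebraMap F (MvPolynomial (Fin 2) F)) (coeff m G) *
        ∏ i, (![X 1, 1, C s, C t, X 0] : Fin 5 → MvPolynomial (Fin 2) F) i ^ m i =
        C (coeff m G * s ^ m 2 * t ^ m 3) * (X 1 ^ m 0 * X 0 ^ m 4) := by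
      simp [Fin.prod_univ_five, algebraMap_eq]
      ring
    rw [this]
    refine (totalDegree_mul _ _).trans ?_
    rw [totalDegree_C, zero_add]
    refine (totalDegree_mul _ _).trans ?_
    rw [totalDegree_X_pow, totalDegree_X_pow]
    omega
  have hg0 : g ≠ 0 := by
    intro h0
    obtain ⟨p, r, u, hpru⟩ := hplane
    apply hpru
    by_cases hr : r = 0
    · simpa [hr] using hline p u
    · have h1 := hev ![u / r, p / r]
      rw [h0, map_zero] at h1
      have h2 := eval_smul_of_isHomogeneous hG r ![p / r, 1, s, t, u / r]
      simp only [Matrix.cons_val_zero, Matrix.cons_val_one] at h1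
      rw [← h1, mul_zero] at h2
      rw [← h2]
      congr 2
      ext i
      fin_cases i <;> simp <;> field_simp
  obtain ⟨m, hm, hle⟩ := exists_card_le_weight (by omega) hZ hg0 (by omega)
    (fun z hz => (hev z).trans (hGZ z hz))
  have h1 := (le_totalDegree hm).trans hdeg
  rw [Finsupp.sum_fintype _ _ (by simp), Fin.sum_univ_two] at h1
  refine hle.trans ?_
  nlinarith [Nat.mul_le_mul_right (q + 1) h1]

/-- The affine Hermitian curve `y ^ q + y = x ^ (q + 1) + e`. -/
def affineCurve (F : Type) [Field F] [Fintype F] [DecidableEq F] (q : ℕ) (e : F) :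
    Finset (Fin 2 → F) :=
  Finset.univ.filter fun z => z 1 ^ q + z 1 = z 0 ^ (q + 1) + e

lemma card_trace_fiber_le [DecidableEq F] {q : ℕ} (hq : 1 < q) (c : F) :
    (Finset.univ.filter fun y : F => y ^ q + y = c).card ≤ q := by
  have hdeg : ((Polynomial.X ^ q + Polynomial.X - Polynomial.C c : Polynomial F)).natDegree = q := by
    have : (Polynomial.X ^ q + Polynomial.X - Polynomial.C c : Polynomial F) =
        Polynomial.X ^ q + (Polynomial.X - Polynomial.C c) := by ring
    rw [this, Polynomial.natDegree_add_eq_left_of_natDegree_lt]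
    · simp
    · rw [Polynomial.natDegree_X_sub_C, Polynomial.natDegree_X_pow]
      exact hq
  have h0 : (Polynomial.X ^ q + Polynomial.X - Polynomial.C c : Polynomial F) ≠ 0 := by
    intro h
    rw [h, Polynomial.natDegree_zero] at hdeg
    omega
  refine le_trans (Finset.card_le_card fun y hy => ?_)
    ((Multiset.toFinset_card_le _).trans ((Polynomial.card_roots' _).trans hdeg.le))
  simp only [Finset.mem_filter, Finset.mem_univ, true_and] at hy
  simp [Polynomial.mem_roots', h0, hy]

lemma card_affineCurve_le [DecidableEq F] {q : ℕ} (hq : 1 < q) (hF : Fintype.card F = q ^ 2)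
    (e : F) : (affineCurve F q e).card ≤ q ^ 3 := by
  have h := Finset.card_le_mul_card_image_of_maps_to (s := affineCurve F q e) (t := Finset.univ)
    (f := fun z => z 0) (fun _ _ => Finset.mem_univ _) q (fun x _ => ?_)
  · rw [Finset.card_univ, hF] at h
    exact h.trans (le_of_eq (by ring))
  · refine le_trans ?_ (card_trace_fiber_le hq (x ^ (q + 1) + e))
    refine Finset.card_le_card_of_injOn (fun z => z 1) (fun z hz => ?_) (fun z hz z' hz' h => ?_)
    · simp only [affineCurve, Finset.coe_filter, Finset.mem_filter, Finset.mem_univ, true_and,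
        Set.mem_ofPred_eq] at hz ⊢
      rw [hz.1, hz.2]
    · simp only [Finset.coe_filter, Set.mem_ofPred_eq] at hz hz'
      ext i
      fin_cases i
      · exact hz.2.trans hz'.2.symm
      · exact h

/-- The zeros of the restriction of `G` to a line through `[1 : 0 : 0 : 0 : 0]`. -/
def linePoints [DecidableEq F] (G : MvPolynomial (Fin 5) F) (y : Fin 4 → F) : Finset F :=
  Finset.univ.filter fun p => eval (Fin.cons p y : Fin 5 → F) G = 0

lemma card_linePoints_le [DecidableEq F] {G : MvPolynomial (Fin 5) F} {y : Fin 4 → F} {i : ℕ}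
    (hi : eval y ((finSuccEquiv F 4 G).coeff i) ≠ 0)
    (hlt : ∀ k, i < k → eval y ((finSuccEquiv F 4 G).coeff k) = 0) :
    (linePoints G y).card ≤ i := by
  set P := Polynomial.map (eval y) (finSuccEquiv F 4 G) with hP
  have h0 : P ≠ 0 := by
    intro h
    apply hi
    rw [← Polynomial.coeff_map, ← hP, h, Polynomial.coeff_zero]
  have hdeg : P.natDegree ≤ i := by
    rw [Polynomial.natDegree_le_iff_coeff_eq_zero]
    intro k hk
    rw [hP, Polynomial.coeff_map, hlt k hk]
  refine le_trans (Finset.card_le_card fun p hp => ?_)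
    ((Multiset.toFinset_card_le _).trans ((Polynomial.card_roots' P).trans hdeg))
  simp only [linePoints, Finset.mem_filter, Finset.mem_univ, true_and,
    eval_eq_eval_mv_eval'] at hp
  simpa [Polynomial.mem_roots', h0] using hp

lemma card_cone_le [DecidableEq F] {q d : ℕ} (hd1 : 1 < d) (hdq : d ≤ q)
    (hF : Fintype.card F = q ^ 2) {G : MvPolynomial (Fin 5) F} (hG : G.IsHomogeneous d)
    (hline : ∀ p u, eval ![p, 0, 0, 0, u] G = 0)
    (hplane : ∃ p s u, eval ![p, 0, s, 0, u] G ≠ 0) :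
    ((affineCurve F q 0).sigma fun z => linePoints G ![0, 1, z 1, z 0]).card +
      (linePoints G ![0, 0, 1, 0]).card ≤ d * (q ^ 3 + q ^ 2) := by
  classical
  have hbig : ∀ k, d < k → (finSuccEquiv F 4 G).coeff k = 0 := by
    intro k hk
    apply Polynomial.coeff_eq_zero_of_natDegree_lt
    rw [natDegree_finSuccEquiv]
    exact ((degreeOf_le_totalDegree _ _).trans hG.totalDegree_le).trans_lt hk
  have hex : ∃ i, i ≤ d ∧ coneCoeff G i ≠ 0 := by
    by_contra! hall
    obtain ⟨p, s, u, hne⟩ := hplane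
    apply hne
    by_cases hs : s = 0
    · simpa [hs] using hline p u
    have h2 := eval_smul_of_isHomogeneous hG s ![p / s, 0, 1, 0, u / s]
    have h1 : eval ![p / s, 0, 1, 0, u / s] G = 0 := by
      have h3 := eval_eq_eval_mv_eval' ![0, 1, 0, u / s] (p / s) G
      have h4 : Polynomial.map (eval ![0, 1, 0, u / s]) (finSuccEquiv F 4 G) = 0 := by
        ext k
        rw [Polynomial.coeff_map, Polynomial.coeff_zero]
        rcases le_or_gt k d with hk | hk
        · have h5 := eval_coneCoeff G k ![u / s, 0]
          rw [hall k hk, map_zero] at h5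
          simpa using h5.symm
        · rw [hbig k hk, map_zero]
      rw [h4, Polynomial.eval_zero] at h3
      exact h3
    rw [h1, mul_zero] at h2
    refine Eq.trans ?_ h2
    congr 2
    ext i
    fin_cases i <;> simp [mul_div_cancel₀, hs]
  set i := Nat.findGreatest (fun i => coneCoeff G i ≠ 0) d with hi
  obtain ⟨i', hi'd, hi'⟩ := hex
  have hi0 : coneCoeff G i ≠ 0 := Nat.findGreatest_spec (P := fun i => coneCoeff G i ≠ 0) hi'd hi'
  have hid : i ≤ d := Nat.findGreatest_le d
  have hgt : ∀ k, i < k → coneCoeff G k = 0 := by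
    intro k hk
    rcases le_or_gt k d with hkd | hkd
    · by_contra h
      exact absurd (Nat.le_findGreatest (P := fun i => coneCoeff G i ≠ 0) hkd h) (by omega)
    · rw [coneCoeff, hbig k hkd, map_zero]
  obtain ⟨j, hij⟩ := Nat.exists_eq_add_of_le hid
  set Z := (affineCurve F q 0).filter fun z => eval z (coneCoeff G i) = 0 with hZdef
  have hdegi := totalDegree_coneCoeff_le hG hij.symm
  obtain ⟨m, hm, hZ⟩ := exists_card_le_weight (Z := Z) (q := q) (e := 0) (by omega)
    (fun z hz => by simpa [hZdef, affineCurve] using (Finset.mem_filter.mp hz).1) hi0 (by omega)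
    (fun z hz => (Finset.mem_filter.mp hz).2)
  have hm' := (le_totalDegree hm).trans hdegi
  rw [Finsupp.sum_fintype _ _ (by simp), Fin.sum_univ_two] at hm'
  change m 0 + m 1 ≤ j at hm'
  have hcard : ∀ y, (linePoints G y).card ≤ q ^ 2 := fun y => by
    rw [← hF]; exact Finset.card_le_univ _
  have hC := card_affineCurve_le (F := F) (q := q) (by omega) hF 0
  have hN2 : ((affineCurve F q 0).sigma fun z => linePoints G ![0, 1, z 1, z 0]).card ≤
      Z.card * q ^ 2 + q ^ 3 * i := by
    rw [Finset.card_sigma, ← Finset.sum_filter_add_sum_filter_not _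
      (fun z => eval z (coneCoeff G i) = 0)]
    refine add_le_add ?_ ?_
    · exact Finset.sum_le_card_nsmul _ _ _ fun z _ => hcard _
    · refine (Finset.sum_le_card_nsmul _ _ i fun z hz => ?_).trans
        (Nat.mul_le_mul_right i ((Finset.card_filter_le _ _).trans hC))
      refine card_linePoints_le ?_ fun k hk => ?_
      · rw [← eval_coneCoeff]; exact (Finset.mem_filter.mp hz).2
      · rw [← eval_coneCoeff, hgt k hk, map_zero]
  have hij' : d * (q ^ 3 + q ^ 2) = i * q ^ 3 + i * q ^ 2 + j * (q + 1) * q ^ 2 := by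
    rw [hij]; ring
  have hq1 : 1 ≤ q ^ 2 := Nat.one_le_pow _ _ (by omega)
  by_cases he : coeff (Finsupp.single 1 j) (coneCoeff G i) = 0
  · have hlt : Z.card + 1 ≤ j * (q + 1) := by
      have hne : m 1 ≠ j := by
        intro h
        apply mem_support_iff.mp hm
        rw [← he]
        congr 1
        ext k
        fin_cases k
        · simp; omega
        · simp [h]
      have hlt : m 1 + 1 ≤ j := by omega
      have : m 0 * q + m 1 * (q + 1) + 1 ≤ j * (q + 1) := by
        have := Nat.mul_le_mul_right q hm'
        nlinarith
      omega
    have := hcard ![0, 0, 1, 0]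
    have := Nat.mul_le_mul_right (q ^ 2) hlt
    nlinarith
  · have hle : Z.card ≤ j * (q + 1) := by
      have := Nat.mul_le_mul_right (q + 1) hm'
      nlinarith
    have h3 : (linePoints G ![0, 0, 1, 0]).card ≤ i := by
      refine card_linePoints_le ?_ fun k hk => ?_
      · rwa [← coeff_coneCoeff hG hij.symm]
      · rcases le_or_gt k d with hkd | hkd
        · obtain ⟨l, hl⟩ := Nat.exists_eq_add_of_le hkd
          rw [← coeff_coneCoeff hG hl.symm, hgt k hk, coeff_zero]
        · rw [hbig k hkd, map_zero]
    have := Nat.mul_le_mul_right (q ^ 2) hle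
    nlinarith

end Slices

section Hermitian

variable {F : Type} [Field F] {σ : F →+* F}

/-- The Hermitian form `∑ xᵢ * σ yᵢ`. -/
def hermForm (σ : F →+* F) : (Fin 5 → F) →ₗ[F] (Fin 5 → F) →ₛₗ[σ] F :=
  LinearMap.mk₂'ₛₗ (RingHom.id F) σ (fun x y => ∑ i, x i * σ (y i))
    (fun x x' y => by simp [add_mul, Finset.sum_add_distrib])
    (fun c x y => by simp [Finset.mul_sum, mul_assoc])
    (fun x y y' => by simp [mul_add, Finset.sum_add_distrib])
    (fun c x y => by simp [Finset.mul_sum, mul_left_comm])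

lemma hermForm_apply (x y : Fin 5 → F) : hermForm σ x y = ∑ i, x i * σ (y i) := rfl

lemma hermForm_symm (hσ : ∀ a, σ (σ a) = a) (x y : Fin 5 → F) :
    hermForm σ y x = σ (hermForm σ x y) := by
  simp [hermForm_apply, hσ, mul_comm]

lemma exists_hermForm_ne_zero {v : Fin 5 → F} (hv : v ≠ 0) : ∃ w, hermForm σ w v ≠ 0 := by
  obtain ⟨i, hi⟩ := Function.ne_iff.mp hv
  refine ⟨Pi.single i 1, ?_⟩
  simpa [hermForm_apply, Pi.single_apply] using hi

lemma exists_isotropic_add_smul (hσ : ∀ a, σ (σ a) = a)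
    (htr : ∀ a, σ a = a → ∃ c, c + σ c = a) {v w : Fin 5 → F} (hv : hermForm σ v v = 0)
    (hvw : hermForm σ w v ≠ 0) : ∃ c : F, hermForm σ (w + c • v) (w + c • v) = 0 := by
  obtain ⟨c, hc⟩ := htr (-hermForm σ w w) (by rw [map_neg, ← hermForm_symm hσ])
  refine ⟨σ c / σ (hermForm σ w v), ?_⟩
  have h1 := hermForm_symm hσ w v
  have h2 : σ (hermForm σ w v) ≠ 0 := by simpa using hvw
  simp only [map_add, map_smul, map_smulₛₗ, LinearMap.add_apply, LinearMap.smul_apply, hv, h1,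
    smul_eq_mul, map_div₀, hσ]
  field_simp
  linear_combination (hermForm σ w v * σ (hermForm σ w v)) * hc

/-- A hyperbolic partner of the isotropic vector `v` inside a submodule. -/
lemma exists_hyperbolic_partner (hσ : ∀ a, σ (σ a) = a)
    (htr : ∀ a, σ a = a → ∃ c, c + σ c = a) (K : Submodule F (Fin 5 → F)) {v w : Fin 5 → F}
    (hvK : v ∈ K) (hwK : w ∈ K) (hv : hermForm σ v v = 0) (hvw : hermForm σ w v ≠ 0) :
    ∃ u ∈ K, hermForm σ u u = 0 ∧ hermForm σ u v = 1 := by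
  set w' := (hermForm σ w v)⁻¹ • w with hw'
  have h1 : hermForm σ w' v = 1 := by simp [hw', hvw]
  obtain ⟨c, hc⟩ := exists_isotropic_add_smul hσ htr hv (w := w') (by simp [h1])
  exact ⟨_, K.add_mem (K.smul_mem _ hwK) (K.smul_mem _ hvK), hc, by
    rw [map_add, LinearMap.add_apply, h1, map_smul, LinearMap.smul_apply, hv, smul_zero, add_zero]⟩

lemma exists_isotropic_of_linearIndependent (hσ : ∀ a, σ (σ a) = a)
    (hnorm : ∀ a, σ a = a → ∃ c, c * σ c = a) (K : Submodule F (Fin 5 → F)) {a b : Fin 5 → F}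
    (ha : a ∈ K) (hb : b ∈ K) (hab : LinearIndependent F ![a, b]) :
    ∃ v ∈ K, v ≠ 0 ∧ hermForm σ v v = 0 := by
  rw [LinearIndependent.pair_iff] at hab
  by_cases haa : hermForm σ a a = 0
  · refine ⟨a, ha, ?_, haa⟩
    rintro rfl
    simpa using hab 1 0
  set k := hermForm σ b a / hermForm σ a a with hk
  have hba : hermForm σ (b - k • a) a = 0 := by simp [hk, haa]
  have hab0 : hermForm σ a (b - k • a) = 0 := by rw [hermForm_symm hσ, hba, map_zero]
  obtain ⟨c, hc⟩ := hnorm (-hermForm σ (b - k • a) (b - k • a) / hermForm σ a a)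
    (by rw [map_div₀, map_neg, ← hermForm_symm hσ, ← hermForm_symm hσ])
  refine ⟨c • a + (b - k • a), K.add_mem (K.smul_mem _ ha) (K.sub_mem hb (K.smul_mem _ ha)), ?_, ?_⟩
  · intro h0
    have := hab (c - k) 1 (by rw [← h0, sub_smul, one_smul]; abel)
    exact one_ne_zero this.2
  · generalize b - k • a = b' at *
    simp only [map_add, map_smul, map_smulₛₗ, LinearMap.add_apply, LinearMap.smul_apply, hba, hab0,
      smul_eq_mul]
    field_simp at hc
    linear_combination hc

/-- The linear map sending the standard basis to the given vectors. -/
def frameMap (v : Fin 5 → Fin 5 → F) : (Fin 5 → F) →ₗ[F] (Fin 5 → F) :=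
  Fintype.linearCombination F v

lemma exists_adapted_frame (hσ : ∀ a, σ (σ a) = a)
    (htr : ∀ a, σ a = a → ∃ c, c + σ c = a) (hnorm : ∀ a, σ a = a → ∃ c, c * σ c = a)
    {P Q : Fin 5 → F} (hP : P ≠ 0) (hPP : hermForm σ P P = 0) (hQP : hermForm σ Q P = 0)
    (hQQ : hermForm σ Q Q ≠ 0) :
    ∃ L : (Fin 5 → F) →ₗ[F] (Fin 5 → F), Function.Injective L ∧
      (∀ x, hermForm σ (L x) (L x) = x 0 * σ (x 1) + x 1 * σ (x 0) + x 2 * σ (x 3) +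
        x 3 * σ (x 2) - x 4 * σ (x 4)) ∧
      ∀ p u, L ![p, 0, 0, 0, u] ∈ Submodule.span F {P, Q} := by
  have hPQ : hermForm σ P Q = 0 := by rw [hermForm_symm hσ, hQP, map_zero]
  obtain ⟨c, hc⟩ := hnorm (-(hermForm σ Q Q)⁻¹) (by rw [map_neg, map_inv₀, ← hermForm_symm hσ])
  set N := c • Q with hN
  have hNN : hermForm σ N N = -1 := by
    have : hermForm σ N N = c * σ c * hermForm σ Q Q := by simp [hN]; ring
    rw [this, hc]
    field_simp
  have hNP : hermForm σ N P = 0 := by simp [hN, hQP]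
  have hPN : hermForm σ P N = 0 := by simp [hN, hPQ]
  -- the isotropic partner of `P` orthogonal to `N`
  obtain ⟨R, hRN, hRR, hRP⟩ : ∃ R, hermForm σ R N = 0 ∧ hermForm σ R R = 0 ∧
      hermForm σ R P = 1 := by
    obtain ⟨w, hw⟩ := exists_hermForm_ne_zero (σ := σ) hP
    obtain ⟨R, hRK, hR⟩ := exists_hyperbolic_partner hσ htr (LinearMap.ker ((hermForm σ).flip N))
      (v := P) (w := w + hermForm σ w N • N) (by simpa using hPN) (by simp [hNN]) hPP
      (by simpa [hNP] using hw)
    exact ⟨R, by simpa using hRK, hR⟩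
  have hPR : hermForm σ P R = 1 := by rw [hermForm_symm hσ, hRP, map_one]
  have hNR : hermForm σ N R = 0 := by rw [hermForm_symm hσ, hRN, map_zero]
  set A : (Fin 5 → F) →ₗ[F] (Fin 3 → F) :=
    LinearMap.pi ![(hermForm σ).flip P, (hermForm σ).flip N, (hermForm σ).flip R] with hA
  have hmem : ∀ x, x ∈ LinearMap.ker A ↔
      hermForm σ x P = 0 ∧ hermForm σ x N = 0 ∧ hermForm σ x R = 0 := by
    intro x
    rw [LinearMap.mem_ker, funext_iff]
    simp [hA, Fin.forall_fin_succ]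
  have hdim : 2 ≤ Module.finrank F (LinearMap.ker A) := by
    have h1 := LinearMap.finrank_range_add_finrank_ker A
    have h2 := Submodule.finrank_le (LinearMap.range A)
    simp only [Module.finrank_fintype_fun_eq_card, Fintype.card_fin] at h1 h2
    omega
  -- an isotropic vector in the orthogonal complement of `P`, `N`, `R`
  obtain ⟨S, hSK, hS0, hSS⟩ : ∃ S ∈ LinearMap.ker A, S ≠ 0 ∧ hermForm σ S S = 0 := by
    have : Nontrivial (LinearMap.ker A) := Module.nontrivial_of_finrank_pos (R := F) (by omega)
    obtain ⟨a, ha⟩ := exists_ne (0 : LinearMap.ker A)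
    obtain ⟨b, hab⟩ := exists_linearIndependent_pair_of_one_lt_finrank (R := F) (by omega) ha
    refine exists_isotropic_of_linearIndependent hσ hnorm (LinearMap.ker A) a.2 b.2 ?_
    rw [LinearIndependent.pair_iff] at hab ⊢
    intro s t hst
    exact hab s t (Subtype.ext hst)
  obtain ⟨hSP, hSN, hSR⟩ := (hmem S).mp hSK
  have hPS : hermForm σ P S = 0 := by rw [hermForm_symm hσ, hSP, map_zero]
  have hNS : hermForm σ N S = 0 := by rw [hermForm_symm hσ, hSN, map_zero]
  have hRS : hermForm σ R S = 0 := by rw [hermForm_symm hσ, hSR, map_zero]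
  obtain ⟨w, hw⟩ := exists_hermForm_ne_zero (σ := σ) hS0
  obtain ⟨T, hTK, hTT, hTS⟩ := exists_hyperbolic_partner hσ htr (LinearMap.ker A) (v := S)
    (w := w - hermForm σ w R • P - hermForm σ w P • R + hermForm σ w N • N) hSK
    ((hmem _).mpr (by simp [hPP, hRP, hNP, hPN, hRN, hNN, hPR, hRR, hNR])) hSS
    (by simpa [hPS, hRS, hNS] using hw)
  obtain ⟨hTP, hTN, hTR⟩ := (hmem T).mp hTK
  have hPT : hermForm σ P T = 0 := by rw [hermForm_symm hσ, hTP, map_zero]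
  have hNT : hermForm σ N T = 0 := by rw [hermForm_symm hσ, hTN, map_zero]
  have hRT : hermForm σ R T = 0 := by rw [hermForm_symm hσ, hTR, map_zero]
  have hST : hermForm σ S T = 1 := by rw [hermForm_symm hσ, hTS, map_one]
  have hL : ∀ x, frameMap ![P, R, S, T, N] x =
      x 0 • P + x 1 • R + x 2 • S + x 3 • T + x 4 • N := fun x => by
    simp [frameMap, Fintype.linearCombination_apply, Fin.sum_univ_five]
  refine ⟨frameMap ![P, R, S, T, N], ?_, fun x => ?_, fun p u => ?_⟩
  · rw [injective_iff_map_eq_zero]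
    intro x hx
    rw [hL] at hx
    have h (v) := congrArg (fun y => hermForm σ y v) hx
    ext i
    fin_cases i
    · simpa [hPR, hRR, hSR, hTR, hNR] using h R
    · simpa [hPP, hRP, hSP, hTP, hNP] using h P
    · simpa [hPT, hRT, hST, hTT, hNT] using h T
    · simpa [hPS, hRS, hSS, hTS, hNS] using h S
    · simpa [hPN, hRN, hSN, hTN, hNN] using h N
  · rw [hL]
    simp only [map_add, map_smul, map_smulₛₗ, LinearMap.add_apply, LinearMap.smul_apply, smul_eq_mul,
      hPP, hRP, hSP, hTP, hNP, hPN, hRN, hSN, hTN, hNN, hPR, hRR, hSR, hTR, hNR, hPS, hRS, hSS, hTS,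
      hNS, hPT, hRT, hST, hTT, hNT]
    ring
  · rw [hL]
    simpa [hN] using add_mem
      (Submodule.smul_mem _ p (Submodule.subset_span (Set.mem_insert P {Q})))
      (Submodule.smul_mem _ u (Submodule.smul_mem _ c
        (Submodule.subset_span (Set.mem_insert_of_mem P (Set.mem_singleton Q)))))

lemma exists_add_frobenius_eq [Fintype F] {q : ℕ} (hq : 1 < q) (hF : Fintype.card F = q ^ 2)
    (hσq : ∀ a, σ a = a ^ q) (hσ : ∀ a, σ (σ a) = a) {a : F} (ha : σ a = a) :
    ∃ c, c + σ c = a := by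
  classical
  obtain ⟨c, hc⟩ : ∃ c, c + σ c ≠ 0 := by
    by_contra! h
    have h1 := card_trace_fiber_le (F := F) hq 0
    rw [Finset.filter_true_of_mem (fun y _ => by rw [← hσq, add_comm, h]), Finset.card_univ, hF] at h1
    nlinarith
  refine ⟨c * (a / (c + σ c)), ?_⟩
  rw [map_mul, map_div₀, map_add, hσ, ha, add_comm (σ c) c, ← add_mul, mul_div_cancel₀ _ hc]

lemma exists_mul_frobenius_eq [Fintype F] {q : ℕ} (hq : 1 < q) (hF : Fintype.card F = q ^ 2)
    (hσq : ∀ a, σ a = a ^ q) {a : F} (ha : σ a = a) : ∃ c, c * σ c = a := by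
  classical
  by_cases ha0 : a = 0
  · exact ⟨0, by simp [ha0]⟩
  obtain ⟨g, hg⟩ := IsCyclic.exists_generator (α := Fˣ)
  obtain ⟨k, hk⟩ := (mem_powers_iff_mem_zpowers.mpr (hg (Units.mk0 a ha0)) :
    Units.mk0 a ha0 ∈ Submonoid.powers g)
  have hord : orderOf g = (q + 1) * (q - 1) := by
    rw [orderOf_eq_card_of_forall_mem_zpowers hg, Nat.card_eq_fintype_card, Fintype.card_units, hF]
    simpa using Nat.sq_sub_sq q 1
  have h1 : g ^ (k * (q - 1)) = 1 := by
    simp only at hk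
    rw [pow_mul, hk]
    ext
    have h2 : a ^ (q - 1) * a = 1 * a := by
      rw [← pow_succ, Nat.sub_add_cancel hq.le, ← hσq, ha, one_mul]
    simpa using mul_right_cancel₀ ha0 h2
  have h2 := orderOf_dvd_of_pow_eq_one h1
  rw [hord] at h2
  obtain ⟨l, rfl⟩ := Nat.dvd_of_mul_dvd_mul_right (by omega) h2
  refine ⟨(g ^ l : Fˣ), ?_⟩
  have := congrArg Units.val hk
  simp only [Units.val_mk0] at this
  rw [hσq, ← this]
  push_cast
  ring

/-- The involution `a ↦ a ^ q` of a field with `q ^ 2` elements. -/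
lemma exists_frobenius [Fintype F] {q : ℕ} (hq : IsPrimePow q) (hF : Fintype.card F = q ^ 2) :
    ∃ σ : F →+* F, (∀ a, σ a = a ^ q) ∧ ∀ a, σ (σ a) = a := by
  obtain ⟨p, k, hp, hk, rfl⟩ := hq
  have hp' : p.Prime := hp.nat_prime
  have : Fact p.Prime := ⟨hp'⟩
  have : CharP F p := by
    obtain ⟨r, hr⟩ := CharP.exists F
    obtain ⟨n, hrp, hn⟩ := FiniteField.card F r
    have : p ∣ r := by
      apply (Nat.Prime.dvd_of_dvd_pow hp' (n := n))
      rw [← hn, hF, ← pow_mul]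
      exact dvd_pow_self p (by omega)
    rwa [(Nat.prime_dvd_prime_iff_eq hp' hrp).mp this]
  refine ⟨iterateFrobenius F p k, fun a => iterateFrobenius_def p k a, fun a => ?_⟩
  rw [iterateFrobenius_def, iterateFrobenius_def, ← pow_mul, ← pow_two, ← hF, FiniteField.pow_card]

end Hermitian

section TangentLine

variable {F : Type} [Field F] {σ : F →+* F} {q : ℕ}

lemma mem_hermV3_iff (hσq : ∀ a, σ a = a ^ q) (x : P4 F) :
    x ∈ hermV3 q F ↔ hermForm σ x.rep x.rep = 0 := by
  simp only [hermV3, Set.mem_ofPred_eq, hermForm_apply, hσq, pow_succ']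

lemma mk_mem_hermV3_iff (hσq : ∀ a, σ a = a ^ q) {v : Fin 5 → F} (hv : v ≠ 0) :
    Projectivization.mk F v hv ∈ hermV3 q F ↔ hermForm σ v v = 0 := by
  obtain ⟨a, ha⟩ := Projectivization.exists_smul_eq_mk_rep F v hv
  rw [mem_hermV3_iff hσq, ← ha]
  simp [Units.smul_def]

lemma mk_mem_VG_iff {d : ℕ} {G : MvPolynomial (Fin 5) F} (hG : G.IsHomogeneous d)
    {v : Fin 5 → F} (hv : v ≠ 0) : Projectivization.mk F v hv ∈ VG G ↔ eval v G = 0 := by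
  obtain ⟨a, ha⟩ := Projectivization.exists_smul_eq_mk_rep F v hv
  rw [VG, Set.mem_ofPred_eq, ← ha, Units.smul_def, eval_smul_of_isHomogeneous hG]
  simp

lemma exists_tangent_vectors (hσq : ∀ a, σ a = a ^ q) (hσ : ∀ a, σ (σ a) = a)
    (htr : ∀ a, σ a = a → ∃ c, c + σ c = a) {W : Submodule F (Fin 5 → F)}
    (hW : Module.finrank F W = 2)
    (hcard : ({x : P4 F | x.submodule ≤ W} ∩ hermV3 q F).ncard = 1) :
    ∃ P ∈ W, ∃ Q ∈ W, P ≠ 0 ∧ hermForm σ P P = 0 ∧ hermForm σ Q P = 0 ∧ hermForm σ Q Q ≠ 0 := by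
  obtain ⟨x, hx⟩ := Set.ncard_eq_one.mp hcard
  have hxm : x ∈ {x : P4 F | x.submodule ≤ W} ∩ hermV3 q F := by rw [hx]; rfl
  obtain ⟨hxW, hxV⟩ := hxm
  rw [mem_hermV3_iff hσq] at hxV
  have hPW : x.rep ∈ W := by
    apply hxW
    rw [Projectivization.submodule_eq]
    exact Submodule.mem_span_singleton_self _
  have huniq : ∀ w ∈ W, hermForm σ w w = 0 → w ∈ Submodule.span F {x.rep} := by
    intro w hw hww
    by_cases hw0 : w = 0
    · rw [hw0]; exact zero_mem _
    have : Projectivization.mk F w hw0 ∈ {x : P4 F | x.submodule ≤ W} ∩ hermV3 q F := by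
      refine ⟨?_, (mk_mem_hermV3_iff hσq hw0).mpr hww⟩
      rw [Set.mem_ofPred_eq, Projectivization.submodule_mk, Submodule.span_singleton_le_iff_mem]
      exact hw
    rw [hx, Set.mem_singleton_iff] at this
    rw [← Projectivization.submodule_eq, ← this, Projectivization.submodule_mk]
    exact Submodule.mem_span_singleton_self _
  obtain ⟨Q, hQW, hQ⟩ : ∃ Q ∈ W, Q ∉ Submodule.span F {x.rep} := by
    by_contra! h
    have h1 := Submodule.finrank_mono (show W ≤ Submodule.span F {x.rep} from h)
    rw [hW, finrank_span_singleton x.rep_nonzero] at h1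
    omega
  refine ⟨x.rep, hPW, Q, hQW, x.rep_nonzero, hxV, ?_, fun h => hQ (huniq Q hQW h)⟩
  by_contra hne
  obtain ⟨c, hc⟩ := exists_isotropic_add_smul hσ htr hxV hne
  have h1 := huniq _ (W.add_mem hQW (W.smul_mem c hPW)) hc
  have h2 := Submodule.sub_mem _ h1
    (Submodule.smul_mem _ c (Submodule.mem_span_singleton_self (R := F) x.rep))
  rw [add_sub_cancel_right] at h2
  exact hQ h2

lemma exists_eval_ne_zero_of_injective {G : MvPolynomial (Fin 5) F}
    (hnoplane : ∀ S : Set (P4 F), IsPlane F S → ¬ S ⊆ VG G)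
    {M : (Fin 3 → F) →ₗ[F] (Fin 5 → F)} (hM : Function.Injective M) :
    ∃ y, eval (M y) G ≠ 0 := by
  have h := hnoplane _ ⟨LinearMap.range M, by simp [LinearMap.finrank_range_of_inj hM], rfl⟩
  rw [Set.not_subset] at h
  obtain ⟨x, hxM, hx⟩ := h
  have : x.rep ∈ LinearMap.range M := by
    apply hxM
    rw [Projectivization.submodule_eq]
    exact Submodule.mem_span_singleton_self _
  obtain ⟨y, hy⟩ := this
  exact ⟨y, by rw [hy]; exact hx⟩

/-- The parametrization of the plane spanned by `e₀`, `v`, `e₄`. -/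
def planeMap (v : Fin 5 → F) : (Fin 3 → F) →ₗ[F] (Fin 5 → F) :=
  Fintype.linearCombination F ![Pi.single 0 1, v, Pi.single 4 1]

lemma planeMap_apply (r s t : F) (y : Fin 3 → F) :
    planeMap ![0, r, s, t, 0] y = ![y 0, y 1 * r, y 1 * s, y 1 * t, y 2] := by
  ext i
  simp only [planeMap, Fintype.linearCombination_apply, Fin.sum_univ_three]
  fin_cases i <;> simp [Matrix.vecHead, Matrix.vecTail]

lemma planeMap_injective {r s t : F} (h : r ≠ 0 ∨ s ≠ 0) :
    Function.Injective (planeMap ![0, r, s, t, 0]) := by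
  rw [injective_iff_map_eq_zero]
  intro y hy
  rw [planeMap_apply] at hy
  have h0 : y 0 = 0 := congrFun hy 0
  have h1 : y 1 * r = 0 := congrFun hy 1
  have h2 : y 1 * s = 0 := congrFun hy 2
  have h4 : y 2 = 0 := congrFun hy 4
  have h3 : y 1 = 0 := by
    rcases h with h | h
    · exact (mul_eq_zero.mp h1).resolve_right h
    · exact (mul_eq_zero.mp h2).resolve_right h
  ext i
  fin_cases i
  · exact h0
  · exact h3
  · exact h4

/-- The polynomial `G` after the linear substitution `L`. -/
def linSubst (L : (Fin 5 → F) →ₗ[F] (Fin 5 → F)) (G : MvPolynomial (Fin 5) F) :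
    MvPolynomial (Fin 5) F :=
  aeval (fun i => ∑ j, C (L (Pi.single j 1) i) * X j) G

lemma eval_linSubst (L : (Fin 5 → F) →ₗ[F] (Fin 5 → F)) (G : MvPolynomial (Fin 5) F)
    (x : Fin 5 → F) : eval x (linSubst L G) = eval (L x) G := by
  rw [linSubst, aeval_def, eval₂_eq', eval_eq' _ G, map_sum]
  have hL : ∀ i, L x i = ∑ j, L (Pi.single j 1) i * x j := by
    intro i
    conv_lhs => rw [LinearMap.pi_apply_eq_sum_univ L x]
    rw [Finset.sum_apply]
    refine Finset.sum_congr rfl fun j _ => ?_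
    rw [Pi.smul_apply, smul_eq_mul, mul_comm]
    have h : (fun k => if j = k then (1 : F) else 0) = Pi.single j 1 := by
      ext k
      simp [Pi.single_apply, eq_comm]
    rw [h]
  refine Finset.sum_congr rfl fun m _ => ?_
  simp [hL, algebraMap_eq]

lemma linSubst_isHomogeneous (L : (Fin 5 → F) →ₗ[F] (Fin 5 → F)) {d : ℕ}
    {G : MvPolynomial (Fin 5) F} (hG : G.IsHomogeneous d) : (linSubst L G).IsHomogeneous d := by
  have := hG.aeval (fun i => ∑ j, C (L (Pi.single j 1) i) * X j) (n := 1)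
    (fun i => IsHomogeneous.sum _ _ _ fun j _ => isHomogeneous_C_mul_X _ _)
  rwa [one_mul] at this

variable [Fintype F]

lemma exists_finset_cover [DecidableEq F] {d : ℕ} (hd1 : 1 < d) (hdq : d ≤ q)
    (hF : Fintype.card F = q ^ 2) (hσq : ∀ a, σ a = a ^ q) {G : MvPolynomial (Fin 5) F}
    (hG : G.IsHomogeneous d) (hline : ∀ p u, eval ![p, 0, 0, 0, u] G = 0)
    (hnoplane : ∀ M : (Fin 3 → F) →ₗ[F] (Fin 5 → F), Function.Injective M → ∃ y, eval (M y) G ≠ 0) :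
    ∃ U : Finset (P4 F), U.card ≤ q ^ 4 * ((d - 1) * (q + 1)) + d * (q ^ 3 + q ^ 2) + 1 ∧
      ∀ (x : Fin 5 → F) (hx : x ≠ 0), eval x G = 0 →
        x 0 * σ (x 1) + x 1 * σ (x 0) + x 2 * σ (x 3) + x 3 * σ (x 2) - x 4 * σ (x 4) = 0 →
        Projectivization.mk F x hx ∈ U := by
  classical
  set Z : F × F → Finset (Fin 2 → F) := fun st =>
    (affineCurve F q (-(st.1 * st.2 ^ q + st.2 * st.1 ^ q))).filter
      fun z => eval ![z 1, 1, st.1, st.2, z 0] G = 0 with hZ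
  have hZcard : ∀ st, (Z st).card ≤ (d - 1) * (q + 1) := by
    intro st
    refine card_affine_slice_le hd1 hdq hF hG hline st.1 st.2 ?_
      (e := -(st.1 * st.2 ^ q + st.2 * st.1 ^ q)) ?_ ?_
    · obtain ⟨y, hy⟩ := hnoplane _ (planeMap_injective (r := 1) (s := st.1) (t := st.2)
        (Or.inl one_ne_zero))
      rw [planeMap_apply, mul_one] at hy
      exact ⟨_, _, _, hy⟩
    · intro z hz
      simpa [affineCurve] using (Finset.mem_filter.mp hz).1
    · intro z hz
      exact (Finset.mem_filter.mp hz).2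
  have hcone := card_cone_le hd1 hdq hF hG hline (by
    obtain ⟨y, hy⟩ := hnoplane _ (planeMap_injective (r := 0) (s := 1) (t := 0)
      (Or.inr one_ne_zero))
    rw [planeMap_apply, mul_one, mul_zero] at hy
    exact ⟨_, _, _, hy⟩)
  set S₁ := (Finset.univ : Finset (F × F)).sigma Z
  set S₂ := (affineCurve F q 0).sigma fun z => linePoints G ![0, 1, z 1, z 0] with hS₂
  set S₃ := linePoints G ![0, 0, 1, 0] with hS₃
  let f₁ : (Σ _ : F × F, Fin 2 → F) → P4 F := fun a =>
    Projectivization.mk F ![a.2 1, 1, a.1.1, a.1.2, a.2 0]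
      (fun h => one_ne_zero (α := F) (congrFun h 1))
  let f₂ : (Σ _ : Fin 2 → F, F) → P4 F := fun a =>
    Projectivization.mk F ![a.2, 0, 1, a.1 1, a.1 0]
      (fun h => one_ne_zero (α := F) (congrFun h 2))
  let f₃ : F → P4 F := fun p =>
    Projectivization.mk F ![p, 0, 0, 1, 0] (fun h => one_ne_zero (α := F) (congrFun h 3))
  let x₀ : P4 F := Projectivization.mk F ![1, 0, 0, 0, 0]
    (fun h => one_ne_zero (α := F) (congrFun h 0))
  refine ⟨S₁.image f₁ ∪ (S₂.image f₂ ∪ S₃.image f₃) ∪ {x₀}, ?_, ?_⟩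
  · have h1 : S₁.card ≤ q ^ 4 * ((d - 1) * (q + 1)) := by
      rw [Finset.card_sigma]
      refine (Finset.sum_le_card_nsmul _ _ _ fun st _ => hZcard st).trans (le_of_eq ?_)
      rw [Finset.card_univ, Fintype.card_prod, hF, smul_eq_mul]
      ring
    refine (Finset.card_union_le _ _).trans (add_le_add ?_ (by simp))
    refine (Finset.card_union_le _ _).trans (add_le_add (Finset.card_image_le.trans h1) ?_)
    refine (Finset.card_union_le _ _).trans (le_trans (add_le_add ?_ ?_) hcone)
    · exact Finset.card_image_le
    · exact Finset.card_image_le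
  intro x hx hGx hform
  have hq0 : q ≠ 0 := by omega
  have hscale : ∀ c : F, eval (c⁻¹ • x) G = 0 := fun c => by
    rw [eval_smul_of_isHomogeneous hG, hGx, mul_zero]
  have hformc : ∀ c : F, (c⁻¹ * x 0) * (c⁻¹ * x 1) ^ q + (c⁻¹ * x 1) * (c⁻¹ * x 0) ^ q +
      (c⁻¹ * x 2) * (c⁻¹ * x 3) ^ q + (c⁻¹ * x 3) * (c⁻¹ * x 2) ^ q
      - (c⁻¹ * x 4) * (c⁻¹ * x 4) ^ q = 0 := fun c => by
    simp only [hσq] at hform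
    simp only [mul_pow]
    linear_combination c⁻¹ * c⁻¹ ^ q * hform
  simp only [Finset.mem_union, Finset.mem_image, Finset.mem_singleton]
  by_cases h1 : x 1 = 0
  · by_cases h2 : x 2 = 0
    · have h4 : x 4 = 0 := by simpa [h1, h2] using hform
      by_cases h3 : x 3 = 0
      · right
        rw [Projectivization.mk_eq_mk_iff']
        refine ⟨x 0, ?_⟩
        ext i
        fin_cases i <;> simp [h1, h2, h3, h4]
      · left; right; right
        have hx' : (x 3)⁻¹ • x = ![(x 3)⁻¹ * x 0, 0, 0, 1, 0] := by
          ext i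
          fin_cases i <;> simp [h1, h2, h3, h4]
        refine ⟨(x 3)⁻¹ * x 0, ?_, ?_⟩
        · have := hscale (x 3)
          rw [hx'] at this
          simpa [hS₃, linePoints] using this
        · rw [Projectivization.mk_eq_mk_iff']
          exact ⟨(x 3)⁻¹, hx'⟩
    · left; right; left
      have hx' : (x 2)⁻¹ • x =
          ![(x 2)⁻¹ * x 0, 0, 1, (x 2)⁻¹ * x 3, (x 2)⁻¹ * x 4] := by
        ext i
        fin_cases i <;> simp [h1, h2]
      refine ⟨⟨![(x 2)⁻¹ * x 4, (x 2)⁻¹ * x 3], (x 2)⁻¹ * x 0⟩, ?_, ?_⟩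
      · have h5 := hscale (x 2)
        rw [hx'] at h5
        have h6 := hformc (x 2)
        rw [h1, inv_mul_cancel₀ h2] at h6
        simp only [hS₂, Finset.mem_sigma, affineCurve, linePoints, Finset.mem_filter,
          Finset.mem_univ, true_and]
        refine ⟨?_, h5⟩
        simp only [Matrix.cons_val_zero, Matrix.cons_val_one, mul_zero, zero_pow hq0, one_pow] at h6 ⊢
        linear_combination h6
      · rw [Projectivization.mk_eq_mk_iff']
        exact ⟨(x 2)⁻¹, hx'⟩
  · left; left
    have hx' : (x 1)⁻¹ • x =
        ![(x 1)⁻¹ * x 0, 1, (x 1)⁻¹ * x 2, (x 1)⁻¹ * x 3, (x 1)⁻¹ * x 4] := by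
      ext i
      fin_cases i <;> simp [h1]
    refine ⟨⟨((x 1)⁻¹ * x 2, (x 1)⁻¹ * x 3), ![(x 1)⁻¹ * x 4, (x 1)⁻¹ * x 0]⟩, ?_, ?_⟩
    · have h5 := hscale (x 1)
      rw [hx'] at h5
      have h6 := hformc (x 1)
      rw [inv_mul_cancel₀ h1] at h6
      simp only [S₁, hZ, Finset.mem_sigma, affineCurve, Finset.mem_filter,
        Finset.mem_univ, true_and]
      refine ⟨?_, h5⟩
      simp only [Matrix.cons_val_zero, Matrix.cons_val_one, one_pow] at h6 ⊢
      linear_combination h6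
    · rw [Projectivization.mk_eq_mk_iff']
      exact ⟨(x 1)⁻¹, hx'⟩

end TangentLine

theorem stmt14 (q : ℕ) (hq : IsPrimePow q)
    (F : Type) [Field F] [Fintype F] (hF : Fintype.card F = q ^ 2)
    (d : ℕ) (hd1 : 1 < d) (hdq : d ≤ q)
    (G : MvPolynomial (Fin 5) F) (hG : G ≠ 0) (hGd : G.IsHomogeneous d)
    (htanline : ∃ ℓ : Set (P4 F), IsLine F ℓ ∧ (ℓ ∩ hermV3 q F).ncard = 1 ∧ ℓ ⊆ VG G)
    (hnoplane : ∀ S : Set (P4 F), IsPlane F S → ¬ S ⊆ VG G) :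
    (VG G ∩ hermV3 q F).ncard ≤
        (d - 1) * q ^ 5 + (d - 1) * q ^ 4 + d * q ^ 3 + d * q ^ 2 + 1 ∧
      (d - 1) * q ^ 5 + (d - 1) * q ^ 4 + d * q ^ 3 + d * q ^ 2 + 1 <
        d * (q ^ 5 + q ^ 2) + q ^ 3 + 1 := by
  classical
  have hq1 : 1 < q := by omega
  constructor
  · obtain ⟨σ, hσq, hσ⟩ := exists_frobenius hq hF
    have htr : ∀ a, σ a = a → ∃ c, c + σ c = a := fun a ha =>
      exists_add_frobenius_eq hq1 hF hσq hσ ha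
    have hnorm : ∀ a, σ a = a → ∃ c, c * σ c = a := fun a ha =>
      exists_mul_frobenius_eq hq1 hF hσq ha
    obtain ⟨_, ⟨W, hW, rfl⟩, hcard, hsub⟩ := htanline
    obtain ⟨P, hPW, Q, hQW, hP, hPP, hQP, hQQ⟩ := exists_tangent_vectors hσq hσ htr hW hcard
    obtain ⟨L, hL, hLform, hLline⟩ := exists_adapted_frame hσ htr hnorm hP hPP hQP hQQ
    have hline : ∀ p u, eval ![p, 0, 0, 0, u] (linSubst L G) = 0 := by
      intro p u
      rw [eval_linSubst]
      have hmem : L ![p, 0, 0, 0, u] ∈ W :=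
        Submodule.span_le.mpr (Set.insert_subset hPW (Set.singleton_subset_iff.mpr hQW))
          (hLline p u)
      by_cases h0 : L ![p, 0, 0, 0, u] = 0
      · have := eval_smul_of_isHomogeneous hGd 0 (L ![p, 0, 0, 0, u])
        rwa [zero_smul, zero_pow (by omega), zero_mul, ← h0] at this
      · refine (mk_mem_VG_iff hGd h0).mp (hsub ?_)
        rw [Set.mem_ofPred_eq, Projectivization.submodule_mk, Submodule.span_singleton_le_iff_mem]
        exact hmem
    obtain ⟨U, hU, hcover⟩ := exists_finset_cover hd1 hdq hF hσq (linSubst_isHomogeneous L hGd)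
      hline (fun M hM => by
        obtain ⟨y, hy⟩ := exists_eval_ne_zero_of_injective hnoplane (M := L ∘ₗ M) (hL.comp hM)
        exact ⟨y, by rwa [eval_linSubst]⟩)
    have hsubset : VG G ∩ hermV3 q F ⊆ ↑(U.image (Projectivization.map L hL)) := by
      rintro x ⟨hxG, hxV⟩
      rw [mem_hermV3_iff hσq] at hxV
      obtain ⟨y, hy⟩ := LinearMap.surjective_of_injective hL x.rep
      have hy0 : y ≠ 0 := by
        rintro rfl
        exact x.rep_nonzero (by rw [← hy, map_zero])
      rw [← hy, hLform] at hxV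
      have hyU := hcover y hy0 (by rw [eval_linSubst, hy]; exact hxG) hxV
      refine Finset.mem_coe.mpr (Finset.mem_image.mpr ⟨_, hyU, ?_⟩)
      rw [Projectivization.map_mk]
      conv_rhs => rw [← x.mk_rep]
      congr 1
    refine (Set.ncard_le_ncard hsubset (Finset.finite_toSet _)).trans ?_
    rw [Set.ncard_coe_finset]
    refine Finset.card_image_le.trans (hU.trans (le_of_eq ?_))
    ring
  · obtain ⟨e, rfl⟩ := Nat.exists_eq_add_of_lt hd1
    obtain ⟨k, rfl⟩ := Nat.exists_eq_add_of_le hdq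
    have : 1 + e + 1 - 1 = e + 1 := by omega
    rw [this]
    set n := 1 + e + 1 + k with hn
    have h1 : (e + 1) * (n + 1) < n ^ 2 := by rw [hn]; nlinarith [Nat.zero_le (e * k)]
    have h2 := Nat.mul_lt_mul_of_pos_right h1 (show 0 < n ^ 3 by positivity)
    nlinarith
end
end

section
/- Let q be a prime power, F a finite field with q^2 elements, and K an algebraic closure of F. Let G ∈ F[x_0,x_1,x_2] be a homogeneous polynomial of degree 3 that is irreducible in F[x_0,x_1,x_2] but whose image in K[x_0,x_1,x_2] is not irreducible. Then the number of points [x] ∈ ℙ^2(F) with G(x) = 0 is at most 1. -/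
open MvPolynomial

noncomputable section

namespace MvPolynomial

variable {σ F K : Type*} [Field F] [Field K] [Algebra F K]

/-- Associated polynomials over a field which share a coefficient equal to one coincide. -/
theorem eq_of_associated_of_coeff_eq_one {p r : MvPolynomial σ K} (h : Associated p r)
    {m : σ →₀ ℕ} (hp : coeff m p = 1) (hr : coeff m r = 1) : p = r := by
  obtain ⟨u, rfl⟩ := h
  have hu := (isUnit_iff_totalDegree_of_isReduced.mp u.isUnit).2
  rw [totalDegree_eq_zero_iff_eq_C] at hu
  rw [hu, mul_comm, coeff_C_mul, hp, mul_one] at hr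
  rw [hu, hr, C_1, mul_one]

/-- Divisibility of polynomials descends along field extensions. -/
theorem dvd_of_map_dvd_map {p r : MvPolynomial σ F}
    (h : map (algebraMap F K) p ∣ map (algebraMap F K) r) : p ∣ r := by
  obtain ⟨s, hs⟩ := h
  obtain ⟨π, hπ⟩ := (Algebra.linearMap F K).exists_leftInverse_of_injective
    (LinearMap.ker_eq_bot.mpr (algebraMap F K).injective)
  have hπ' (a : F) : π (algebraMap F K a) = a := LinearMap.congr_fun hπ a
  let t : MvPolynomial σ F := ∑ m ∈ s.support, monomial m (π (coeff m s))
  have ht (m : σ →₀ ℕ) : coeff m t = π (coeff m s) := by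
    classical
    simp only [t, coeff_sum, coeff_monomial, Finset.sum_ite_eq']
    split_ifs with hm
    · rfl
    · rw [notMem_support_iff.mp hm, map_zero]
  refine ⟨t, ?_⟩
  classical
  ext m
  have := congrArg (fun f ↦ π (coeff m f)) hs
  simpa [coeff_mul, coeff_map, hπ', ht, ← Algebra.smul_def] using this

/-- A polynomial fixed by the Galois group is defined over the base field. -/
theorem mem_range_map_of_fixed [IsGalois F K] {p : MvPolynomial σ K}
    (h : ∀ τ : Gal(K/F), map (τ : K →+* K) p = p) :
    ∃ r : MvPolynomial σ F, map (algebraMap F K) r = p := by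
  have : p ∈ Set.range (map (σ := σ) (algebraMap F K)) := by
    rw [mem_range_map_iff_coeffs_subset]
    intro c hc
    obtain ⟨m, -, rfl⟩ := mem_coeffs_iff.mp hc
    refine (InfiniteGalois.mem_range_algebraMap_iff_fixed _).mpr fun τ ↦ ?_
    have := congrArg (coeff m) (h τ)
    simpa [coeff_map] using this
  exact this

/-- Every normalized geometric irreducible factor of an irreducible polynomial vanishes at all
rational zeros of that polynomial. -/
theorem eval_eq_zero_of_dvd_map [IsGalois F K] {G : MvPolynomial σ F} (hG : Irreducible G)
    {M : MvPolynomial σ K} (hM : Irreducible M) (hMG : M ∣ map (algebraMap F K) G)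
    {m : σ →₀ ℕ} (hm : coeff m M = 1) {x : σ → F} (hx : eval x G = 0) :
    eval (algebraMap F K ∘ x) M = 0 := by
  classical
  have hG0 : map (algebraMap F K) G ≠ 0 :=
    (map_ne_zero_iff _ (map_injective _ (algebraMap F K).injective)).mpr hG.ne_zero
  let S : Set (MvPolynomial σ K) := Set.range fun τ : Gal(K/F) ↦ map (τ : K →+* K) M
  have hcoeff : ∀ p ∈ S, coeff m p = 1 := by
    rintro _ ⟨τ, rfl⟩
    simp [coeff_map, hm]
  have hdvd : ∀ p ∈ S, p ∣ map (algebraMap F K) G := by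
    rintro _ ⟨τ, rfl⟩
    have := map_dvd (map (σ := σ) (τ : K →+* K)) hMG
    rwa [map_map, show (τ : K →+* K).comp (algebraMap F K) = algebraMap F K from
      τ.toAlgHom.comp_algebraMap] at this
  have hirr : ∀ p ∈ S, Irreducible p := by
    rintro _ ⟨τ, rfl⟩
    exact (MulEquiv.irreducible_iff (mapEquiv σ (τ : K ≃+* K))).mpr hM
  have hfin : S.Finite := by
    have hfac (p : S) := UniqueFactorizationMonoid.exists_mem_factors_of_dvd hG0
      (hirr p p.2) (hdvd p p.2)
    choose f hf hpf using hfac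
    have : Finite S := Finite.of_injective
      (fun p ↦ (⟨f p, Multiset.mem_toFinset.mpr (hf p)⟩ :
        (UniqueFactorizationMonoid.factors (map (algebraMap F K) G)).toFinset)) fun p r hpr ↦ by
        have hpr' : f p = f r := congrArg Subtype.val hpr
        exact Subtype.ext (eq_of_associated_of_coeff_eq_one
          ((hpf p).trans (hpr' ▸ (hpf r).symm)) (hcoeff p p.2) (hcoeff r r.2))
    exact S.toFinite
  let N := ∏ p ∈ hfin.toFinset, p
  have hNG : N ∣ map (algebraMap F K) G := by
    refine Finset.prod_dvd_of_isRelPrime (fun p hp r hr hne ↦ ?_) (by simpa using hdvd)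
    simp only [Finset.mem_coe, Set.Finite.mem_toFinset] at hp hr
    refine (hirr p hp).isRelPrime_iff_not_dvd.mpr fun h ↦ hne ?_
    exact eq_of_associated_of_coeff_eq_one
      (((hirr p hp).dvd_irreducible_iff_associated (hirr r hr)).mp h) (hcoeff p hp) (hcoeff r hr)
  have hMS : M ∈ S := ⟨1, map_id M⟩
  obtain ⟨n, hn⟩ : ∃ n : MvPolynomial σ F, map (algebraMap F K) n = N := by
    refine mem_range_map_of_fixed fun τ ↦ ?_
    rw [map_prod]
    refine Finset.prod_nbij (map (τ : K →+* K)) ?_ ?_ ?_ (fun _ _ ↦ rfl)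
    · intro p hp
      simp only [Set.Finite.mem_toFinset] at hp ⊢
      obtain ⟨τ', rfl⟩ := hp
      exact ⟨τ * τ', by simp only [map_map]; rfl⟩
    · exact (map_injective _ (τ : K →+* K).injective).injOn
    · intro p hp
      simp only [Finset.mem_coe, Set.Finite.mem_toFinset] at hp
      obtain ⟨τ', rfl⟩ := hp
      refine ⟨map ((τ⁻¹ * τ' : Gal(K/F)) : K →+* K) M, by simp [S], ?_⟩
      simp only [map_map]
      congr 2
      ext a
      simp
  have hMN : M ∣ N := Finset.dvd_prod_of_mem _ (by simpa using hMS)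
  have hnG : n ∣ G := dvd_of_map_dvd_map (K := K) (hn ▸ hNG)
  have hn_unit : ¬ IsUnit n := fun hu ↦
    hM.not_isUnit (isUnit_of_dvd_unit hMN (hn ▸ hu.map (map (algebraMap F K))))
  have hGn : G ∣ n := ((hG.dvd_iff.mp hnG).resolve_left hn_unit).dvd
  have hev : eval x n = 0 := zero_dvd_iff.mp (hx ▸ map_dvd (eval x) hGn)
  have hcomm (τ : K →+* K) (hτ : ∀ a, τ (algebraMap F K a) = algebraMap F K a)
      (p : MvPolynomial σ K) : eval (algebraMap F K ∘ x) (map τ p) =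
        τ (eval (algebraMap F K ∘ x) p) := by
    have hτx : τ ∘ algebraMap F K ∘ x = algebraMap F K ∘ x := _root_.funext fun i ↦ hτ (x i)
    have := eval₂_comp_left τ (RingHom.id K) (algebraMap F K ∘ x) p
    rw [hτx, RingHom.comp_id, eval₂_id] at this
    rw [eval_map, this]
  have hevN : eval (algebraMap F K ∘ x) N = 0 := by
    have := eval₂_comp_left (algebraMap F K) (RingHom.id F) x n
    rw [RingHom.comp_id, eval₂_id, hev, map_zero] at this
    rw [← hn, eval_map, ← this]
  rw [map_prod, Finset.prod_eq_zero_iff] at hevN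
  obtain ⟨p, hp, hp0⟩ := hevN
  simp only [Set.Finite.mem_toFinset] at hp
  obtain ⟨τ, rfl⟩ := hp
  rw [hcomm _ (fun a ↦ τ.commutes a)] at hp0
  exact (map_eq_zero _).mp hp0

theorem eq_C_add_sum_of_totalDegree_le_one [Fintype σ] {p : MvPolynomial σ K}
    (hp : p.totalDegree ≤ 1) :
    p = C (coeff 0 p) + ∑ i, C (coeff (Finsupp.single i 1) p) * X i := by
  classical
  ext m
  simp only [coeff_add, coeff_C, coeff_sum, coeff_C_mul, coeff_X, mul_ite, mul_one, mul_zero]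
  rcases Nat.lt_or_ge 1 m.degree with hm | hm
  · rw [if_neg (by rintro rfl; simp at hm), Finset.sum_eq_zero, add_zero]
    · exact coeff_eq_zero_of_totalDegree_lt (hp.trans_lt hm)
    · intro i _
      rw [if_neg]
      rintro rfl
      simp at hm
  · rcases Nat.le_one_iff_eq_zero_or_eq_one.mp hm with hm | hm
    · obtain rfl := (Finsupp.degree_eq_zero_iff m).mp hm
      simp
    · obtain ⟨j, rfl⟩ : ∃ j, m = Finsupp.single j 1 := by
        obtain ⟨j, hj⟩ : ∃ j, m j ≠ 0 := by
          by_contra! h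
          simp [show m = 0 from Finsupp.ext h] at hm
        obtain ⟨k, rfl⟩ := exists_add_of_le
          (Finsupp.single_le_iff.mpr (Nat.one_le_iff_ne_zero.mpr hj))
        rw [map_add, Finsupp.degree_single, Nat.add_eq_left, Finsupp.degree_eq_zero_iff] at hm
        exact ⟨j, by rw [hm, add_zero]⟩
      have hne : (0 : σ →₀ ℕ) ≠ Finsupp.single j 1 :=
        (Finsupp.single_ne_zero.mpr one_ne_zero).symm
      simp [Finsupp.single_left_inj, hne]

/-- A linear form whose coefficients are normalized and orthogonal to two independent vectors over
a subfield has all coefficients in that subfield. -/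
theorem mem_range_of_dotProduct_eq_zero {v w : Fin 3 → F} (hvw : LinearIndependent F ![v, w])
    {a : Fin 3 → K} {j : Fin 3} (hj : a j = 1)
    (hv : a 0 * algebraMap F K (v 0) + a 1 * algebraMap F K (v 1)
      + a 2 * algebraMap F K (v 2) = 0)
    (hw : a 0 * algebraMap F K (w 0) + a 1 * algebraMap F K (w 1)
      + a 2 * algebraMap F K (w 2) = 0) (i : Fin 3) :
    ∃ b, algebraMap F K b = a i := by
  let c := crossProduct v w
  have hc : c ≠ 0 := crossProduct_ne_zero_iff_linearIndependent.mpr hvw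
  have hprop (i k : Fin 3) : a i * algebraMap F K (c k) = a k * algebraMap F K (c i) := by
    fin_cases i <;> fin_cases k <;> simp [c, cross_apply] <;> first
      | linear_combination (algebraMap F K (v 0)) * hw - (algebraMap F K (w 0)) * hv
      | linear_combination -(algebraMap F K (v 0)) * hw + (algebraMap F K (w 0)) * hv
      | linear_combination (algebraMap F K (v 1)) * hw - (algebraMap F K (w 1)) * hv
      | linear_combination -(algebraMap F K (v 1)) * hw + (algebraMap F K (w 1)) * hv
      | linear_combination (algebraMap F K (v 2)) * hw - (algebraMap F K (w 2)) * hv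
      | linear_combination -(algebraMap F K (v 2)) * hw + (algebraMap F K (w 2)) * hv
  have hci (k : Fin 3) : algebraMap F K (c k) = a k * algebraMap F K (c j) := by
    rw [← hprop j k, hj, one_mul]
  have hcj : algebraMap F K (c j) ≠ 0 := by
    intro h
    refine hc (show c = 0 from _root_.funext fun k ↦ ?_)
    have := hci k
    rwa [h, mul_zero, map_eq_zero] at this
  exact ⟨c i / c j, by rw [map_div₀, hci i, mul_div_cancel_right₀ _ hcj]⟩

end MvPolynomial

theorem stmt16 (q : ℕ) (hq : IsPrimePow q)
    (F : Type) [Field F] [Fintype F] (hF : Fintype.card F = q ^ 2)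
    (K : Type) [Field K] [Algebra F K] [IsAlgClosure F K]
    (G : MvPolynomial (Fin 3) F) (hGd : G.IsHomogeneous 3)
    (hirr : Irreducible G)
    (hnotabs : ¬ Irreducible (MvPolynomial.map (algebraMap F K) G)) :
    {x : Projectivization F (Fin 3 → F) | eval x.rep G = 0}.ncard ≤ 1 := by
  have : Algebra.IsAlgebraic F K := IsAlgClosure.isAlgebraic
  have : IsGalois F K := {  }
  have hinj : Function.Injective (map (σ := Fin 3) (algebraMap F K)) :=
    map_injective _ (algebraMap F K).injective
  have hdeg (p : MvPolynomial (Fin 3) F) :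
      (map (algebraMap F K) p).totalDegree = p.totalDegree :=
    by simp only [totalDegree, support_map_of_injective p (algebraMap F K).injective]
  have hG3 : G.totalDegree = 3 := hGd.totalDegree hirr.ne_zero
  have hG0 : map (algebraMap F K) G ≠ 0 := (map_ne_zero_iff _ hinj).mpr hirr.ne_zero
  obtain ⟨A, hAG, hA1⟩ : ∃ A, A ∣ map (algebraMap F K) G ∧ A.totalDegree = 1 := by
    have hunit (p : MvPolynomial (Fin 3) K) (hp : p ≠ 0) (hd : p.totalDegree = 0) : IsUnit p := by
      rw [totalDegree_eq_zero_iff_eq_C] at hd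
      rw [hd] at hp ⊢
      exact (IsUnit.mk0 _ (by simpa using hp)).map C
    have hGu : ¬ IsUnit (map (algebraMap F K) G) := fun h ↦ by
      have := (isUnit_iff_totalDegree_of_isReduced.mp h).2
      rw [hdeg] at this
      lia
    rw [irreducible_iff] at hnotabs
    push Not at hnotabs
    obtain ⟨A, B, hAB, hA, hB⟩ := hnotabs hGu
    have hne := hAB ▸ hG0
    have hA0 := left_ne_zero_of_mul hne
    have hB0 := right_ne_zero_of_mul hne
    have hsum := totalDegree_mul_of_isDomain hA0 hB0
    rw [← hAB, hdeg, hG3] at hsum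
    have hA' : A.totalDegree ≠ 0 := fun h ↦ hA (hunit A hA0 h)
    have hB' : B.totalDegree ≠ 0 := fun h ↦ hB (hunit B hB0 h)
    by_cases h : A.totalDegree = 1
    · exact ⟨A, ⟨B, hAB⟩, h⟩
    · exact ⟨B, ⟨A, by rw [hAB, mul_comm]⟩, by lia⟩
  obtain ⟨j, hj⟩ : ∃ j, coeff (Finsupp.single j 1) A ≠ 0 := by
    by_contra! h
    rw [eq_C_add_sum_of_totalDegree_le_one hA1.le] at hA1
    simp [h] at hA1
  set d := coeff (Finsupp.single j 1) A with hd
  let L := C d⁻¹ * A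
  have hCd : IsUnit (C d⁻¹ : MvPolynomial (Fin 3) K) := (IsUnit.mk0 _ (inv_ne_zero hj)).map C
  have hLj : coeff (Finsupp.single j 1) L = 1 := by
    rw [coeff_C_mul, ← hd, inv_mul_cancel₀ hj]
  have hLG : L ∣ map (algebraMap F K) G := hCd.mul_left_dvd.mpr hAG
  have hL1 : L.totalDegree = 1 := by
    rw [totalDegree_mul_of_isDomain hCd.ne_zero (by rintro rfl; simp at hA1), totalDegree_C, hA1]
  have hLirr : Irreducible L := irreducible_of_totalDegree_eq_one hL1 fun x hx ↦
    isUnit_of_dvd_one (hLj ▸ hx _)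
  have hLeq := eq_C_add_sum_of_totalDegree_le_one hL1.le
  have hL0 : coeff 0 L = 0 := by
    have h := eval_eq_zero_of_dvd_map hirr hLirr hLG hLj (x := 0) (by
      rw [eval_zero, constantCoeff_eq]
      exact hGd.coeff_eq_zero (by simp))
    rw [hLeq] at h
    simpa using h
  have hzero (x : Fin 3 → F) (hx : eval x G = 0) :
      coeff (Finsupp.single 0 1) L * algebraMap F K (x 0)
        + coeff (Finsupp.single 1 1) L * algebraMap F K (x 1)
        + coeff (Finsupp.single 2 1) L * algebraMap F K (x 2) = 0 := by
    have h := eval_eq_zero_of_dvd_map hirr hLirr hLG hLj hx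
    rw [hLeq, hL0] at h
    simpa [Fin.sum_univ_three] using h
  rw [Set.ncard_le_one (Set.toFinite _)]
  intro x hx y hy
  by_contra hxy
  have hrange := mem_range_of_dotProduct_eq_zero
    (a := fun i ↦ coeff (Finsupp.single i 1) L)
    (Projectivization.linearIndependent_pair_iff_ne.mpr hxy) hLj (hzero _ hx) (hzero _ hy)
  choose b hb using hrange
  let l : MvPolynomial (Fin 3) F := ∑ i, C (b i) * X i
  have hl : map (algebraMap F K) l = L := by
    rw [hLeq, hL0]
    simp [l, hb]
  have hl1 : l.totalDegree = 1 := by rw [← hdeg, hl, hL1]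
  have hlG : l ∣ G := dvd_of_map_dvd_map (K := K) (hl ▸ hLG)
  have hl_unit : ¬ IsUnit l := fun hu ↦ by
    have := (isUnit_iff_totalDegree_of_isReduced.mp hu).2
    lia
  obtain ⟨s, hs⟩ := ((hirr.dvd_iff.mp hlG).resolve_left hl_unit)
  have := totalDegree_mul_of_isDomain hirr.ne_zero s.ne_zero
  rw [hs, (isUnit_iff_totalDegree_of_isReduced.mp s.isUnit).2] at this
  lia
end
end
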